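/- Great-grandparent weight doubling in optimal alphabetic trees: let T be an optimal alphabetic tree. For every node a of T that has a great-grandparent f (the ancestor three levels above a), w(f) ≥ 2·w(a). Hence in an OAT the subtree weight grows by at least a factor of two for every three levels. -/

import Mathlib

/-- Binary trees in which every internal node has exactly two children and
every leaf carries a nonnegative real weight. -/
inductive WTree : Type
  | leaf : ℝ → WTree
  | node : WTree → WTree → WTree

namespace WTree

/-- The weights of the leaves in left-to-right order. -/
def leaves : WTree → List ℝ
  | leaf x => [x]
  | node l r => leaves l ++ leaves r

/-- The total weight of the leaves of a tree. -/
def wt (t : WTree) : ℝ := t.leaves.sum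

/-- The cost `Σ aᵢ dᵢ` of an alphabetic tree (each leaf weight times its
depth), computed recursively. -/
def cost : WTree → ℝ
  | leaf _ => 0
  | node l r => cost l + cost r + wt l + wt r

/-- `t` is an optimal alphabetic tree: it minimizes cost among all alphabetic
trees on the same left-to-right sequence of leaf weights. -/
def IsOAT (t : WTree) : Prop :=
  ∀ t' : WTree, t'.leaves = t.leaves → cost t ≤ cost t'

/-- `IsSubtree s t`: `s` occurs as (the subtree rooted at) a node of `t`. -/
inductive IsSubtree : WTree → WTree → Prop
  | refl (t : WTree) : IsSubtree t t
  | left {s l r : WTree} : IsSubtree s l → IsSubtree s (node l r)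
  | right {s l r : WTree} : IsSubtree s r → IsSubtree s (node l r)

end WTree

/-- `IsChild s t`: `s` is one of the two children of the internal node `t`. -/
def WTree.IsChild (s t : WTree) : Prop :=
  ∃ l r : WTree, t = WTree.node l r ∧ (s = l ∨ s = r)

namespace WTree

theorem wt_node (l r : WTree) : wt (node l r) = wt l + wt r := by
  simp [wt, leaves]

theorem wt_eq_of_leaves_eq {s t : WTree} (h : s.leaves = t.leaves) : s.wt = t.wt := by
  rw [wt, wt, h]

theorem IsSubtree.mem_leaves {s t : WTree} (h : IsSubtree s t) {x : ℝ} (hx : x ∈ s.leaves) :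
    x ∈ t.leaves := by
  induction h with
  | refl => exact hx
  | left _ ih => exact List.mem_append_left _ ih
  | right _ ih => exact List.mem_append_right _ ih

/-- Every subtree of an optimal alphabetic tree is optimal. -/
theorem IsOAT.of_isSubtree {s t : WTree} (ht : t.IsOAT) (h : IsSubtree s t) : s.IsOAT := by
  induction h with
  | refl => exact ht
  | @left l r _ ih =>
    refine ih fun l' hl => ?_
    have h := ht (node l' r) (by simp [leaves, hl])
    simp only [cost, wt_eq_of_leaves_eq hl] at h
    linarith
  | @right l r _ ih =>
    refine ih fun r' hr => ?_
    have h := ht (node l r') (by simp [leaves, hr])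
    simp only [cost, wt_eq_of_leaves_eq hr] at h
    linarith

/-- Rotating `((x, y), z)` to `(x, (y, z))` does not improve an optimal tree. -/
theorem IsOAT.wt_le_of_left_left {x y z : WTree} (h : (node (node x y) z).IsOAT) :
    x.wt ≤ z.wt := by
  have := h (node x (node y z)) (by simp [leaves])
  simp only [cost, wt_node] at this
  linarith

/-- Rotating `(x, (y, z))` to `((x, y), z)` does not improve an optimal tree. -/
theorem IsOAT.wt_le_of_right_right {x y z : WTree} (h : (node x (node y z)).IsOAT) :
    z.wt ≤ x.wt := by
  have := h (node (node x y) z) (by simp [leaves])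
  simp only [cost, wt_node] at this
  linarith

/-- Rebalancing `(x, ((y, z), u))` to `((x, y), (z, u))` does not improve an optimal tree. -/
theorem IsOAT.wt_add_le_of_right_left {x y z u : WTree}
    (h : (node x (node (node y z) u)).IsOAT) : y.wt + z.wt ≤ x.wt := by
  have := h (node (node x y) (node z u)) (by simp [leaves])
  simp only [cost, wt_node] at this
  linarith

/-- Rebalancing `((x, (y, z)), u)` to `((x, y), (z, u))` does not improve an optimal tree. -/
theorem IsOAT.wt_add_le_of_left_right {x y z u : WTree}
    (h : (node (node x (node y z)) u).IsOAT) : y.wt + z.wt ≤ u.wt := by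
  have := h (node (node x y) (node z u)) (by simp [leaves])
  simp only [cost, wt_node] at this
  linarith

theorem wt_nonneg {t : WTree} (h : ∀ x ∈ t.leaves, 0 ≤ x) : 0 ≤ t.wt :=
  List.sum_nonneg h

end WTree

/-- **Great-grandparent weight doubling in optimal alphabetic trees.**
In an optimal alphabetic tree `T` (with nonnegative weights), if a node `a`
has a great-grandparent `f` (i.e. `f` is a node of `T`, `e` is a child of
`f`, `c` is a child of `e`, and `a` is a child of `c`), then
`w(f) ≥ 2·w(a)`: the subtree weight at least doubles every three levels. -/
theorem oat_great_grandparent_doubling (T : WTree)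
    (hnn : ∀ x ∈ T.leaves, (0 : ℝ) ≤ x) (hopt : T.IsOAT) :
    ∀ f e c a : WTree, WTree.IsSubtree f T →
      WTree.IsChild e f → WTree.IsChild c e → WTree.IsChild a c →
      2 * a.wt ≤ f.wt := by
  rintro f e c a hf ⟨e₁, e₂, rfl, he⟩ ⟨c₁, c₂, rfl, hc⟩ ⟨a₁, a₂, rfl, ha⟩
  replace hopt := hopt.of_isSubtree hf
  replace hnn : ∀ s, WTree.IsSubtree s (.node e₁ e₂) → 0 ≤ s.wt := fun s hs =>
    WTree.wt_nonneg fun x hx => hnn x (hf.mem_leaves (hs.mem_leaves hx))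
  rcases he with rfl | rfl <;> rcases hc with rfl | rfl
  · have h := hopt.wt_le_of_left_left
    have h₁ := hnn a₁ (.left (.left (.left (.refl _))))
    have h₂ := hnn a₂ (.left (.left (.right (.refl _))))
    have h₃ := hnn c₂ (.left (.right (.refl _)))
    simp only [WTree.wt_node] at *
    rcases ha with rfl | rfl <;> linarith
  · have h := hopt.wt_add_le_of_left_right
    have h₁ := hnn a₁ (.left (.right (.left (.refl _))))
    have h₂ := hnn a₂ (.left (.right (.right (.refl _))))
    have h₃ := hnn c₁ (.left (.left (.refl _)))
    simp only [WTree.wt_node] at *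
    rcases ha with rfl | rfl <;> linarith
  · have h := hopt.wt_add_le_of_right_left
    have h₁ := hnn a₁ (.right (.left (.left (.refl _))))
    have h₂ := hnn a₂ (.right (.left (.right (.refl _))))
    have h₃ := hnn c₂ (.right (.right (.refl _)))
    simp only [WTree.wt_node] at *
    rcases ha with rfl | rfl <;> linarith
  · have h := hopt.wt_le_of_right_right
    have h₁ := hnn a₁ (.right (.right (.left (.refl _))))
    have h₂ := hnn a₂ (.right (.right (.right (.refl _))))
    have h₃ := hnn c₁ (.right (.left (.refl _)))
    simp only [WTree.wt_node] at *
    rcases ha with rfl | rfl <;> linarith
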